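/- Under Assumption (A1), for every α ∈ (0,1) and every Storey parameter s0 ∈ {0,…,n−1}, the ASLC procedure at level α satisfies bFDR(ASLC) ≤ α. -/

import Mathlib

open MeasureTheory Finset

noncomputable section

attribute [local instance] Classical.propDecidable

/-- The conformal p-value of test point `i` (scores are `s 1, …, s (n+m)`,
calibration scores are `s 1, …, s n`, the `i`-th test score is `s (n+i)`). -/
def pval (n : ℕ) (s : ℕ → ℝ) (i : ℕ) : ℝ :=
  (1 + (((Finset.Icc 1 n)).filter (fun j => s (n + i) ≤ s j)).card) / (n + 1)

/-- The p-value attached to the `k`-th largest test score, with the convention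
`pOrd … 0 = 0`. -/
def pOrd (n : ℕ) (s : ℕ → ℝ) (σ : ℕ → ℕ) (k : ℕ) : ℝ :=
  if k = 0 then 0 else pval n s (σ k)

/-- The largest element of `argmin_{k ∈ {0,…,m}} f k`. -/
def maxArgmin (m : ℕ) (f : ℕ → ℝ) : ℕ :=
  sSup {k | k ≤ m ∧ ∀ k' ≤ m, f k ≤ f k'}

/-- The largest element of the argmin of `f` over `{k ∈ {0,…,m} | P k}`. -/
def maxArgminOn (m : ℕ) (P : ℕ → Prop) (f : ℕ → ℝ) : ℕ :=
  sSup {k | k ≤ m ∧ P k ∧ ∀ k' ≤ m, P k' → f k ≤ f k'}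

/-- The SL (support line) index `k̂_SL` at level `α`. -/
def khatSL (n m : ℕ) (α : ℝ) (s : ℕ → ℝ) (σ : ℕ → ℕ) : ℕ :=
  maxArgmin m (fun k => pOrd n s σ k - α * k / m)

/-- The SLC (support line conformal) index `k̂_SLC` at level `α`. -/
def khatSLC (n m : ℕ) (α : ℝ) (s : ℕ → ℝ) (σ : ℕ → ℕ) : ℕ :=
  maxArgmin m (fun k => pOrd n s σ k - k * max (α / m - 1 / (n + 1)) 0)

/-- `σ` is the permutation of `{1,…,m}` ordering the test scores decreasingly,
with the convention `σ 0 = 0`. -/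
def SortsTest (n m : ℕ) (s : ℕ → ℝ) (σ : ℕ → ℕ) : Prop :=
  σ 0 = 0 ∧ Set.BijOn σ (Finset.Icc 1 m) (Finset.Icc 1 m) ∧
    ∀ k ∈ Finset.Icc 1 m, ∀ k' ∈ Finset.Icc 1 m, k < k' → s (n + σ k') < s (n + σ k)

/-- `σ'` enumerates the subsample `A ⊆ {1,…,m}` so that the corresponding test
scores are decreasing, with the convention `σ' 0 = 0`. -/
def SortsSub (n : ℕ) (s : ℕ → ℝ) (A : Finset ℕ) (σ' : ℕ → ℕ) : Prop :=
  σ' 0 = 0 ∧ Set.BijOn σ' (Finset.Icc 1 A.card) ↑A ∧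
    ∀ k ∈ Finset.Icc 1 A.card, ∀ k' ∈ Finset.Icc 1 A.card, k < k' →
      s (n + σ' k') < s (n + σ' k)

/-- The indices of the calibration scores together with the indices of the
null test scores. -/
def NullIdx (n : ℕ) (H0 : Finset ℕ) : Finset ℕ :=
  Finset.Icc 1 n ∪ H0.image (fun i => n + i)

/-- Assumption (A1), first part: the joint law of the scores is invariant under any
permutation of the coordinates indexed by `{1,…,n} ∪ {n+i : i ∈ H0}` fixing all the
other coordinates. -/
def ExchangeableNulls {Ω : Type*} [MeasurableSpace Ω] (μ : Measure Ω)
    (n : ℕ) (H0 : Finset ℕ) (S : Ω → ℕ → ℝ) : Prop :=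
  ∀ e : Equiv.Perm ℕ, (∀ j ∉ NullIdx n H0, e j = j) →
    Measure.map (fun ω => fun j => S ω (e j)) μ = Measure.map S μ

/-- The event `Ω_i`: the largest test score other than `S_{n+i}` is at least the
maximum of the calibration scores and of `S_{n+i}`. -/
def OmegaEvent {Ω : Type*} (n m : ℕ) (S : Ω → ℕ → ℝ) (i : ℕ) : Set Ω :=
  {ω | ∃ j ∈ (Finset.Icc 1 m).erase i,
    ∀ l ∈ Finset.Icc 1 n ∪ {n + i}, S ω l ≤ S ω (n + j)}

/-- The Storey estimator `π̂₀` with parameter `s0`. -/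
def storey (n m s0 : ℕ) (s : ℕ → ℝ) : ℝ :=
  (1 + (((Finset.Icc 1 m)).filter
      (fun i => ((s0 : ℝ) + 1) / (n + 1) ≤ pval n s i)).card) /
    (m * (1 - ((s0 : ℝ) + 1) / (n + 1)))

/-- The adaptive SL index `k̂_ASL` at level `α` with Storey parameter `s0`. -/
def khatASL (n m s0 : ℕ) (α : ℝ) (s : ℕ → ℝ) (σ : ℕ → ℕ) : ℕ :=
  maxArgminOn m (fun k => pOrd n s σ k ≤ (s0 : ℝ) / (n + 1))
    (fun k => pOrd n s σ k - α * k / (m * storey n m s0 s))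

/-- The adaptive SLC index `k̂_ASLC` at level `α` with Storey parameter `s0`. -/
def khatASLC (n m s0 : ℕ) (α : ℝ) (s : ℕ → ℝ) (σ : ℕ → ℕ) : ℕ :=
  maxArgmin m (fun k =>
    pOrd n s σ k - k * max (α / (m * storey n m s0 s) - 1 / (n + 1)) 0)

/-- The rejection set of the top-`k` procedure: all test points whose score is at
least the `k`-th largest one in the (sub)ordering `σ'` (empty if `k = 0`). -/
def rejSet (n m : ℕ) (s : ℕ → ℝ) (σ' : ℕ → ℕ) (k : ℕ) : Finset ℕ :=
  if k = 0 then ∅ else (Finset.Icc 1 m).filter (fun i => s (n + σ' k) ≤ s (n + i))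

/-- Probability of drawing a given subsample, for the uniform distribution over
subsets of `{1,…,m}` of cardinality `t`. -/
def subProb (m t : ℕ) (A : Finset ℕ) : ENNReal :=
  if A ∈ (Finset.Icc 1 m).powersetCard t
    then (((Finset.Icc 1 m).powersetCard t).card : ENNReal)⁻¹ else 0

/-- The `q`-th largest value among `v 0, …, v (B-1)`. -/
def kthLargest (B q : ℕ) (v : ℕ → ℕ) : ℕ :=
  sSup {t | q ≤ ((Finset.range B).filter (fun b => t ≤ v b)).card}

/-- The adaptive subsampled index: ASLC applied to a subsample of size `t`
(enumerated by `σ'`), where the Storey estimator is computed on the full test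
sample of size `m`. -/
def khatASLCsub (n m t s0 : ℕ) (α : ℝ) (s : ℕ → ℝ) (σ' : ℕ → ℕ) : ℕ :=
  maxArgminOn t (fun k => pOrd n s σ' k ≤ (s0 : ℝ) / (n + 1))
    (fun k => pOrd n s σ' k - k * max (α / (storey n m s0 s * t) - 1 / (n + 1)) 0)


/-- number of calibration scores at least test score `j` -/
def cC (n : ℕ) (s : ℕ → ℝ) (j : ℕ) : ℕ :=
  ((Finset.Icc 1 n).filter (fun l => s (n + j) ≤ s l)).card

/-- rank of test score `j` among test scores -/
def cD (n m : ℕ) (s : ℕ → ℝ) (j : ℕ) : ℕ :=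
  ((Finset.Icc 1 m).filter (fun l => s (n + j) ≤ s (n + l))).card

/-- number of test points with at least `t` calibration scores above -/
def cN (n m t : ℕ) (s : ℕ → ℝ) : ℕ :=
  ((Finset.Icc 1 m).filter (fun j => t ≤ cC n s j)).card

/-- rescaled slope -/
def sl (n m s0 : ℕ) (α : ℝ) (s : ℕ → ℝ) : ℝ :=
  α * (n - s0) / (cN n m s0 s + 1) - 1

/-- test point `i` is the boundary point -/
def EE (n m s0 : ℕ) (α : ℝ) (i : ℕ) (s : ℕ → ℝ) : Prop :=
  0 < sl n m s0 α s ∧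
  (1 + cC n s i : ℝ) - sl n m s0 α s * cD n m s i ≤ 0 ∧
  (∀ j ∈ Finset.Icc 1 m, (1 + cC n s i : ℝ) - sl n m s0 α s * cD n m s i ≤
    (1 + cC n s j : ℝ) - sl n m s0 α s * cD n m s j) ∧
  (∀ j ∈ Finset.Icc 1 m, s (n + j) < s (n + i) →
    (1 + cC n s i : ℝ) - sl n m s0 α s * cD n m s i <
    (1 + cC n s j : ℝ) - sl n m s0 α s * cD n m s j)

/-- indicator of `EE` -/
def gE (n m s0 : ℕ) (α : ℝ) (i : ℕ) (s : ℕ → ℝ) : ℝ :=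
  if EE n m s0 α i s then 1 else 0

/-- comparison function -/
def gG (n m s0 : ℕ) (α : ℝ) (i : ℕ) (s : ℕ → ℝ) : ℝ :=
  if s0 + 1 ≤ cC n s i then α / (cN n m (s0 + 1) s) else 0

/-- index set -/
def II (n i : ℕ) : Finset ℕ := insert (n + i) (Finset.Icc 1 n)

/-- swapped score vector -/
def sw (n i l : ℕ) (s : ℕ → ℝ) : ℕ → ℝ := fun x => s (Equiv.swap (n + i) l x)

lemma card_filter_erase' (A : Finset ℕ) (a : ℕ) (ha : a ∈ A) (p : ℕ → Prop)
    [DecidablePred p] :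
    (A.filter p).card = ((A.erase a).filter p).card + if p a then 1 else 0 := by
  conv_lhs => rw [← Finset.insert_erase ha]
  rw [Finset.filter_insert]
  split_ifs with h
  · rw [Finset.card_insert_of_notMem (by simp)]
  · simp

lemma sw_i (n i l : ℕ) (s : ℕ → ℝ) : sw n i l s (n + i) = s l := by simp [sw]

lemma sw_j (n i l j : ℕ) (s : ℕ → ℝ) (hl : l ∈ II n i) (hj : 1 ≤ j) (hji : j ≠ i) :
    sw n i l s (n + j) = s (n + j) := by
  simp only [II, Finset.mem_insert, Finset.mem_Icc] at hl
  unfold sw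
  rw [Equiv.swap_apply_of_ne_of_ne] <;> omega

lemma card_sw (n i l : ℕ) (hi : 1 ≤ i) (s : ℕ → ℝ) (hl : l ∈ II n i) (y : ℝ) :
    ((Finset.Icc 1 n).filter (fun x => y ≤ sw n i l s x)).card + (if y ≤ s l then 1 else 0)
      = ((II n i).filter (fun x => y ≤ s x)).card := by
  rw [card_filter_erase' _ l hl]
  congr 1
  have key : ∀ x, x ∈ Finset.Icc 1 n ↔ Equiv.swap (n + i) l x ∈ (II n i).erase l := by
    intro x
    simp only [II, Finset.mem_insert, Finset.mem_Icc, Finset.mem_erase] at hl ⊢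
    rcases eq_or_ne x (n + i) with h | h
    · subst h; simp; omega
    rcases eq_or_ne x l with h' | h'
    · subst h'; simp; omega
    rw [Equiv.swap_apply_of_ne_of_ne h h']
    omega
  refine Finset.card_bij' (fun x _ => Equiv.swap (n + i) l x) (fun x _ => Equiv.swap (n + i) l x)
    ?_ ?_ ?_ ?_
  · intro x hx
    rw [Finset.mem_filter] at hx ⊢
    exact ⟨(key x).1 hx.1, hx.2⟩
  · intro x hx
    rw [Finset.mem_filter] at hx ⊢
    refine ⟨(key _).2 (by simpa using hx.1), by simpa [sw] using hx.2⟩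
  · simp
  · simp

/-- ranks in the extended calibration sample -/
def rr (n i : ℕ) (s : ℕ → ℝ) (y : ℝ) : ℕ := ((II n i).filter (fun x => y ≤ s x)).card

/-- number of other test points above -/
def qq (n m i : ℕ) (s : ℕ → ℝ) (y : ℝ) : ℕ :=
  (((Finset.Icc 1 m).erase i).filter (fun x => y ≤ s (n + x))).card

lemma cC_sw_i (n i l : ℕ) (hi : 1 ≤ i) (s : ℕ → ℝ) (hl : l ∈ II n i) :
    cC n (sw n i l s) i + 1 = rr n i s (s l) := by
  unfold cC rr
  rw [sw_i, ← card_sw n i l hi s hl]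
  simp

lemma cC_sw_j (n i l j : ℕ) (hi : 1 ≤ i) (s : ℕ → ℝ) (hl : l ∈ II n i) (hj : 1 ≤ j)
    (hji : j ≠ i) :
    cC n (sw n i l s) j + (if s (n + j) ≤ s l then 1 else 0) = rr n i s (s (n + j)) := by
  unfold cC rr
  rw [sw_j n i l j s hl hj hji, ← card_sw n i l hi s hl]

lemma cD_sw (n m i l : ℕ) (hi : i ∈ Finset.Icc 1 m) (s : ℕ → ℝ) (hl : l ∈ II n i) (j : ℕ) :
    cD n m (sw n i l s) j = qq n m i s (sw n i l s (n + j)) +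
      if sw n i l s (n + j) ≤ s l then 1 else 0 := by
  unfold cD qq
  rw [card_filter_erase' _ i hi, sw_i]
  congr 2
  apply Finset.filter_congr
  intro x hx
  rw [Finset.mem_erase, Finset.mem_Icc] at hx
  rw [sw_j n i l x s hl hx.2.1 hx.1]

lemma cN_sw (n m t i l : ℕ) (hi : i ∈ Finset.Icc 1 m) (s : ℕ → ℝ) :
    cN n m t (sw n i l s) = (((Finset.Icc 1 m).erase i).filter
        (fun j => t ≤ cC n (sw n i l s) j)).card +
      if t ≤ cC n (sw n i l s) i then 1 else 0 := by
  unfold cN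
  rw [card_filter_erase' _ i hi]

/-- the swap-invariant count -/
def MM (n m s0 i : ℕ) (s : ℕ → ℝ) : ℕ :=
  (((Finset.Icc 1 m).erase i).filter (fun j => s0 + 1 ≤ rr n i s (s (n + j)))).card

lemma MM_le (n m s0 i l : ℕ) (hi : i ∈ Finset.Icc 1 m) (s : ℕ → ℝ) (hl : l ∈ II n i) :
    MM n m s0 i s ≤ cN n m s0 (sw n i l s) := by
  rw [cN_sw n m s0 i l hi]
  refine le_trans (Finset.card_le_card ?_) (Nat.le_add_right _ _)
  intro j hj
  rw [Finset.mem_filter] at hj ⊢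
  refine ⟨hj.1, ?_⟩
  have hj1 := hj.1
  rw [Finset.mem_erase, Finset.mem_Icc] at hj1
  have := cC_sw_j n i l j (Finset.mem_Icc.1 hi).1 s hl hj1.2.1 hj1.1
  have := hj.2
  split_ifs at * <;> omega

lemma MM_eq (n m s0 i l : ℕ) (hi : i ∈ Finset.Icc 1 m) (s : ℕ → ℝ) (hl : l ∈ II n i)
    (hF : s0 + 1 ≤ cC n (sw n i l s) i) :
    cN n m (s0 + 1) (sw n i l s) = MM n m s0 i s + 1 := by
  rw [cN_sw n m _ i l hi, if_pos hF]
  unfold MM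
  congr 2
  apply Finset.filter_congr
  intro j hj
  rw [Finset.mem_erase, Finset.mem_Icc] at hj
  have h := cC_sw_j n i l j (Finset.mem_Icc.1 hi).1 s hl hj.2.1 hj.1
  constructor
  · intro h'; omega
  · intro h'
    by_cases hc : s (n + j) ≤ s l
    · refine le_trans hF ?_
      unfold cC
      apply Finset.card_le_card
      intro x hx
      rw [Finset.mem_filter] at hx ⊢
      refine ⟨hx.1, le_trans ?_ hx.2⟩
      rw [sw_i, sw_j n i l j s hl hj.2.1 hj.1]
      exact hc
    · rw [if_neg hc] at h
      omega

lemma rr_anti (n i : ℕ) (s : ℕ → ℝ) {x y : ℝ} (h : x ≤ y) : rr n i s y ≤ rr n i s x := by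
  apply Finset.card_le_card
  intro z hz
  rw [Finset.mem_filter] at hz ⊢
  exact ⟨hz.1, h.trans hz.2⟩

lemma rr_strict (n i l : ℕ) (hl : l ∈ II n i) (s : ℕ → ℝ) {y : ℝ} (h : s l < y) :
    rr n i s y + 1 ≤ rr n i s (s l) := by
  apply Finset.card_lt_card
  rw [Finset.ssubset_iff_of_subset]
  · exact ⟨l, by simp [hl], by simp [h]⟩
  · intro z hz
    rw [Finset.mem_filter] at hz ⊢
    exact ⟨hz.1, h.le.trans hz.2⟩

lemma qq_anti (n m i : ℕ) (s : ℕ → ℝ) {x y : ℝ} (h : x ≤ y) : qq n m i s y ≤ qq n m i s x := by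
  apply Finset.card_le_card
  intro z hz
  rw [Finset.mem_filter] at hz ⊢
  exact ⟨hz.1, h.trans hz.2⟩

lemma cN_mono (n m s0 i l l' : ℕ) (hi : i ∈ Finset.Icc 1 m) (s : ℕ → ℝ) (hl : l ∈ II n i)
    (hl' : l' ∈ II n i) (h : s l' ≤ s l) :
    cN n m s0 (sw n i l s) ≤ cN n m s0 (sw n i l' s) := by
  apply Finset.card_le_card
  intro j hj
  rw [Finset.mem_filter] at hj ⊢
  refine ⟨hj.1, hj.2.trans ?_⟩
  have hi1 := (Finset.mem_Icc.1 hi).1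
  have hj1 := (Finset.mem_Icc.1 hj.1).1
  by_cases hji : j = i
  · subst hji
    have h1 := cC_sw_i n j l hi1 s hl
    have h2 := cC_sw_i n j l' hi1 s hl'
    have := rr_anti n j s h
    omega
  · have h1 := cC_sw_j n i l j hi1 s hl hj1 hji
    have h2 := cC_sw_j n i l' j hi1 s hl' hj1 hji
    by_cases hc : s (n + j) ≤ s l'
    · rw [if_pos (hc.trans h)] at h1
      rw [if_pos hc] at h2
      omega
    · rw [if_neg hc] at h2
      omega

/-- the lowest other test point above `s l'`. -/
lemma exists_low (n m i l' : ℕ) (hl' : l' ∈ II n i) (s : ℕ → ℝ)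
    (hne : ∀ j ∈ (Finset.Icc 1 m).erase i, s (n + j) ≠ s l') :
    qq n m i s (s l') = 0 ∨ ∃ j ∈ (Finset.Icc 1 m).erase i, s l' < s (n + j) ∧
      qq n m i s (s (n + j)) = qq n m i s (s l') ∧ rr n i s (s (n + j)) + 1 ≤ rr n i s (s l') := by
  rcases Finset.eq_empty_or_nonempty
    (((Finset.Icc 1 m).erase i).filter (fun x => s l' ≤ s (n + x))) with h | h
  · left; unfold qq; rw [h]; rfl
  · right
    obtain ⟨j, hj, hmin⟩ := Finset.exists_min_image _ (fun x => s (n + x)) h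
    rw [Finset.mem_filter] at hj
    have hlt : s l' < s (n + j) := lt_of_le_of_ne hj.2 (hne j hj.1).symm
    refine ⟨j, hj.1, hlt, ?_, rr_strict n i l' hl' s hlt⟩
    unfold qq
    congr 1
    apply Finset.filter_congr
    intro x hx
    constructor
    · intro h'; exact hlt.le.trans h'
    · intro h'; exact hmin x (Finset.mem_filter.2 ⟨hx, h'⟩)

lemma II_sub (n m i : ℕ) (hi : i ∈ Finset.Icc 1 m) {l : ℕ} (hl : l ∈ II n i) :
    l ∈ (Finset.Icc 1 (n + m) : Set ℕ) := by
  simp only [II, Finset.mem_insert, Finset.mem_Icc, Finset.coe_Icc, Set.mem_Icc] at *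
  omega

lemma hne' (n m : ℕ) (i : ℕ) (hi : i ∈ Finset.Icc 1 m)
    (s : ℕ → ℝ) (hinj : Set.InjOn s (Finset.Icc 1 (n + m)))
    {l : ℕ} (hl : l ∈ II n i) : ∀ j ∈ (Finset.Icc 1 m).erase i, s (n + j) ≠ s l := by
  intro j hj h
  have h1 := II_sub n m i hi hl
  simp only [II, Finset.mem_insert, Finset.mem_Icc, Finset.mem_erase] at hl hj
  have := hinj (by simp; omega) h1 h
  omega

set_option linter.unusedVariables false in
lemma val_i (n m : ℕ) (i : ℕ) (hi : i ∈ Finset.Icc 1 m)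
    (s : ℕ → ℝ) (hinj : Set.InjOn s (Finset.Icc 1 (n + m)))
    {l : ℕ} (hl : l ∈ II n i) : (1 + cC n (sw n i l s) i : ℝ) = rr n i s (s l) ∧
    (cD n m (sw n i l s) i : ℝ) = qq n m i s (s l) + 1 := by
  have h1 := cC_sw_i n i l (Finset.mem_Icc.1 hi).1 s hl
  have h2 := cD_sw n m i l hi s hl i
  rw [sw_i] at h2
  simp only [le_refl, if_true] at h2
  constructor
  · rw [← h1]; push_cast; ring
  · rw [h2]; push_cast; ring

lemma cand_P (n m s0 : ℕ) (α : ℝ) (i : ℕ) (hi : i ∈ Finset.Icc 1 m)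
    (s : ℕ → ℝ) (hinj : Set.InjOn s (Finset.Icc 1 (n + m)))
    {l l' : ℕ} (hl : l ∈ II n i) (hl' : l' ∈ II n i)
    (hE : EE n m s0 α i (sw n i l s)) (h : s l ≤ s l') :
    (rr n i s (s l) : ℝ) - sl n m s0 α (sw n i l s) * (qq n m i s (s l) + 1) ≤
      rr n i s (s l') - sl n m s0 α (sw n i l s) * qq n m i s (s l') := by
  obtain ⟨hB, h0, hle, -⟩ := hE
  obtain ⟨v1, v2⟩ := val_i n m i hi s hinj hl
  rw [v1, v2] at h0
  rcases exists_low n m i l' hl' s (hne' n m i hi s hinj hl') with hq | ⟨j, hj, hlt, hq, hr⟩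
  · rw [hq]
    have : (0 : ℝ) ≤ rr n i s (s l') := by positivity
    push_cast
    linarith
  · have hj1 := hj
    rw [Finset.mem_erase, Finset.mem_Icc] at hj1
    have := hle j (Finset.mem_of_mem_erase hj)
    rw [v1, v2] at this
    have h3 := cC_sw_j n i l j (Finset.mem_Icc.1 hi).1 s hl hj1.2.1 hj1.1
    have h4 := cD_sw n m i l hi s hl j
    rw [sw_j n i l j s hl hj1.2.1 hj1.1] at h4
    have hn : ¬ s (n + j) ≤ s l := not_le.2 (h.trans_lt hlt)
    rw [if_neg hn] at h3 h4
    rw [add_zero] at h3 h4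
    rw [h3, h4, hq] at this
    have hr' : (rr n i s (s (n + j)) : ℝ) + 1 ≤ rr n i s (s l') := by exact_mod_cast hr
    linarith

lemma cand_F (n m s0 : ℕ) (α : ℝ) (i : ℕ) (hi : i ∈ Finset.Icc 1 m)
    (s : ℕ → ℝ) (hinj : Set.InjOn s (Finset.Icc 1 (n + m)))
    {l l' : ℕ} (hl : l ∈ II n i) (hl' : l' ∈ II n i)
    (hE : EE n m s0 α i (sw n i l s)) (h : s l' < s l) :
    sl n m s0 α (sw n i l s) * ((qq n m i s (s l') : ℝ) - qq n m i s (s l)) ≤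
      (rr n i s (s l') : ℝ) - rr n i s (s l) - 1 := by
  obtain ⟨hB, -, -, hlt'⟩ := hE
  obtain ⟨v1, v2⟩ := val_i n m i hi s hinj hl
  have hqa := qq_anti n m i s h.le
  have hrs : (rr n i s (s l) : ℝ) + 1 ≤ rr n i s (s l') := by
    exact_mod_cast rr_strict n i l' hl' s h
  rcases exists_low n m i l' hl' s (hne' n m i hi s hinj hl') with hq | ⟨j, hj, hlt, hq, hr⟩
  · have : qq n m i s (s l) = 0 := by omega
    rw [hq, this]; simp; linarith
  · have hj1 := hj
    rw [Finset.mem_erase, Finset.mem_Icc] at hj1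
    by_cases hc : s (n + j) < s l
    · have := hlt' j (Finset.mem_of_mem_erase hj) (by
        rw [sw_i, sw_j n i l j s hl hj1.2.1 hj1.1]; exact hc)
      rw [v1, v2] at this
      have h3 := cC_sw_j n i l j (Finset.mem_Icc.1 hi).1 s hl hj1.2.1 hj1.1
      have h4 := cD_sw n m i l hi s hl j
      rw [sw_j n i l j s hl hj1.2.1 hj1.1] at h4
      rw [if_pos hc.le] at h3 h4
      rw [h4, hq] at this
      have h3' : (cC n (sw n i l s) j : ℝ) + 1 = rr n i s (s (n + j)) := by exact_mod_cast h3
      have hr' : (rr n i s (s (n + j)) : ℝ) + 1 ≤ rr n i s (s l') := by exact_mod_cast hr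
      push_cast at this
      linarith
    · have := qq_anti n m i s (not_lt.1 hc)
      have : qq n m i s (s l) = qq n m i s (s l') := by omega
      rw [this]; simp; linarith

lemma card_sep (T : Finset ℕ) (f : ℕ → ℝ) (x L : ℝ) (hL : 0 ≤ L)
    (h1 : ∀ a ∈ T, x ≤ f a ∧ f a ≤ x + L)
    (h2 : ∀ a ∈ T, ∀ b ∈ T, a ≠ b → f a + 1 ≤ f b ∨ f b + 1 ≤ f a) : (T.card : ℝ) ≤ L + 1 := by
  have : T.card ≤ (Finset.range (⌊L⌋₊ + 1)).card := by
    apply Finset.card_le_card_of_injOn (fun a => ⌊f a - x⌋₊)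
    · intro a ha
      have := h1 a ha
      simp only [Finset.coe_range, Set.mem_Iio]
      exact Nat.lt_succ_of_le (Nat.floor_le_floor (by linarith))
    · intro a ha b hb hab
      by_contra hne
      simp only at hab
      have ha1 := h1 a ha
      have hb1 := h1 b hb
      have e1 := Nat.floor_le (sub_nonneg.2 ha1.1)
      have e2 := Nat.floor_le (sub_nonneg.2 hb1.1)
      have e3 := Nat.lt_floor_add_one (f a - x)
      have e4 := Nat.lt_floor_add_one (f b - x)
      rw [hab] at e1 e3
      rcases h2 a ha b hb hne with h | h <;> linarith
  rw [Finset.card_range] at this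
  have h3 := Nat.floor_le hL
  have : (T.card : ℝ) ≤ ⌊L⌋₊ + 1 := by exact_mod_cast this
  linarith

lemma card_cand (n m s0 : ℕ) (α : ℝ) (i : ℕ) (hi : i ∈ Finset.Icc 1 m)
    (s : ℕ → ℝ) (hinj : Set.InjOn s (Finset.Icc 1 (n + m)))
    (hα : 0 ≤ α) (hs0 : s0 < n) :
    (((II n i).filter (fun l => EE n m s0 α i (sw n i l s))).card : ℝ) ≤
      α * (n - s0) / (MM n m s0 i s + 1) := by
  have hns : (0 : ℝ) ≤ n - s0 := by
    have : (s0 : ℝ) < n := by exact_mod_cast hs0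
    linarith
  set T := (II n i).filter (fun l => EE n m s0 α i (sw n i l s)) with hT
  rcases Finset.eq_empty_or_nonempty T with h | h
  · rw [h]; simp; positivity
  obtain ⟨t, ht, hmin⟩ := Finset.exists_min_image T s h
  have htT := (Finset.mem_filter.1 ht)
  have hB := htT.2.1
  have key := card_sep T (fun l => (rr n i s (s l) : ℝ) -
      sl n m s0 α (sw n i t s) * qq n m i s (s l))
    ((rr n i s (s t) : ℝ) - sl n m s0 α (sw n i t s) * qq n m i s (s t) -
      sl n m s0 α (sw n i t s)) (sl n m s0 α (sw n i t s)) hB.le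
  have sep : ∀ a ∈ T, ∀ b ∈ T, s b < s a → (rr n i s (s a) : ℝ) -
      sl n m s0 α (sw n i t s) * qq n m i s (s a) + 1 ≤ (rr n i s (s b) : ℝ) -
      sl n m s0 α (sw n i t s) * qq n m i s (s b) := by
    intro a ha b hb hab
    have ha' := Finset.mem_filter.1 ha
    have hb' := Finset.mem_filter.1 hb
    have h1 := cand_F n m s0 α i hi s hinj ha'.1 hb'.1 ha'.2 hab
    have h2 : (qq n m i s (s a) : ℝ) ≤ qq n m i s (s b) := by exact_mod_cast qq_anti n m i s hab.le
    have h3 : sl n m s0 α (sw n i t s) ≤ sl n m s0 α (sw n i a s) := by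
      unfold sl
      have : (cN n m s0 (sw n i a s) : ℝ) ≤ cN n m s0 (sw n i t s) := by
        exact_mod_cast cN_mono n m s0 i a t hi s ha'.1 htT.1 (hmin a ha)
      gcongr
    have := mul_le_mul_of_nonneg_right h3 (sub_nonneg.2 h2)
    linarith
  have hstrict : ∀ a ∈ T, ∀ b ∈ T, a ≠ b → s a ≠ s b := by
    intro a ha b hb hab h
    exact hab (hinj (II_sub n m i hi (Finset.mem_filter.1 ha).1)
      (II_sub n m i hi (Finset.mem_filter.1 hb).1) h)
  have key2 := key ?_ ?_
  · refine key2.trans ?_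
    have : (MM n m s0 i s : ℝ) ≤ cN n m s0 (sw n i t s) := by
      exact_mod_cast MM_le n m s0 i t hi s htT.1
    unfold sl
    rw [sub_add_cancel]
    gcongr
  · intro a ha
    have ha' := Finset.mem_filter.1 ha
    have := cand_P n m s0 α i hi s hinj htT.1 ha'.1 htT.2 (hmin a ha)
    refine ⟨by linarith, ?_⟩
    rcases eq_or_ne a t with h | h
    · subst h; linarith
    · have := sep a ha t ht (lt_of_le_of_ne (hmin a ha) (hstrict t ht a ha h.symm))
      linarith
  · intro a ha b hb hab
    rcases lt_or_gt_of_ne (hstrict a ha b hb hab) with h | h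
    · right; exact sep b hb a ha h
    · left; exact sep a ha b hb h

lemma card_F (n m s0 : ℕ) (i : ℕ) (hi : i ∈ Finset.Icc 1 m)
    (s : ℕ → ℝ) (hinj : Set.InjOn s (Finset.Icc 1 (n + m)))
    (hs0 : s0 < n) :
    n - s0 ≤ ((II n i).filter (fun l => s0 + 1 ≤ cC n (sw n i l s) i)).card := by
  have hi1 := (Finset.mem_Icc.1 hi).1
  have h1 : ((II n i).filter (fun l => ¬ s0 + 1 ≤ cC n (sw n i l s) i)).card ≤
      (Finset.range (s0 + 1)).card := by
    apply Finset.card_le_card_of_injOn (fun l => cC n (sw n i l s) i)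
    · intro l hl
      have := (Finset.mem_filter.1 hl).2
      simp only [Finset.coe_range, Set.mem_Iio]
      omega
    · intro a ha b hb hab
      have ha := (Finset.mem_filter.1 ha).1
      have hb := (Finset.mem_filter.1 hb).1
      simp only at hab
      have e1 := cC_sw_i n i a hi1 s ha
      have e2 := cC_sw_i n i b hi1 s hb
      rcases lt_trichotomy (s a) (s b) with h | h | h
      · have := rr_strict n i a ha s h
        omega
      · exact hinj (II_sub n m i hi ha) (II_sub n m i hi hb) h
      · have := rr_strict n i b hb s h
        omega
  have h2 := Finset.card_filter_add_card_filter_not (s := II n i)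
    (fun l => s0 + 1 ≤ cC n (sw n i l s) i)
  have h3 : (II n i).card = n + 1 := by
    unfold II
    rw [Finset.card_insert_of_notMem (by simp; omega)]; simp
  rw [Finset.card_range] at h1
  omega

lemma pointwise (n m s0 : ℕ) (α : ℝ) (i : ℕ) (hi : i ∈ Finset.Icc 1 m)
    (s : ℕ → ℝ) (hinj : Set.InjOn s (Finset.Icc 1 (n + m)))
    (hα : 0 ≤ α) (hs0 : s0 < n) :
    ∑ l ∈ II n i, gE n m s0 α i (sw n i l s) ≤ ∑ l ∈ II n i, gG n m s0 α i (sw n i l s) := by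
  have h1 : ∑ l ∈ II n i, gE n m s0 α i (sw n i l s) =
      ((II n i).filter (fun l => EE n m s0 α i (sw n i l s))).card := by
    unfold gE
    rw [Finset.sum_boole]
  have h2 : ∑ l ∈ II n i, gG n m s0 α i (sw n i l s) =
      ((II n i).filter (fun l => s0 + 1 ≤ cC n (sw n i l s) i)).card *
        (α / (MM n m s0 i s + 1)) := by
    unfold gG
    rw [← Finset.sum_filter, ← nsmul_eq_mul]
    apply Finset.sum_eq_card_nsmul
    intro l hl
    rw [Finset.mem_filter] at hl
    rw [MM_eq n m s0 i l hi s hl.1 hl.2]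
    push_cast; rfl
  rw [h1, h2]
  refine (card_cand n m s0 α i hi s hinj hα hs0).trans ?_
  have h3 : ((n : ℝ) - s0) ≤ ((II n i).filter (fun l => s0 + 1 ≤ cC n (sw n i l s) i)).card := by
    have := card_F n m s0 i hi s hinj hs0
    rw [← Nat.cast_sub hs0.le]
    exact_mod_cast this
  calc α * (n - s0) / (MM n m s0 i s + 1) = (n - s0) * (α / (MM n m s0 i s + 1)) := by ring
    _ ≤ _ := by gcongr

lemma sum_gG (n m s0 : ℕ) (α : ℝ) (hα : 0 ≤ α) (H0 : Finset ℕ) (hH0 : H0 ⊆ Finset.Icc 1 m)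
    (s : ℕ → ℝ) : ∑ i ∈ H0, gG n m s0 α i s ≤ α := by
  unfold gG
  rw [← Finset.sum_filter, Finset.sum_const, nsmul_eq_mul]
  have h : ((H0.filter (fun i => s0 + 1 ≤ cC n s i)).card : ℝ) ≤ cN n m (s0 + 1) s := by
    unfold cN
    exact_mod_cast Finset.card_le_card (Finset.filter_subset_filter _ hH0)
  rcases Nat.eq_zero_or_pos (cN n m (s0 + 1) s) with h0 | h0
  · rw [h0]; simpa using hα
  · have : (0 : ℝ) < cN n m (s0 + 1) s := by exact_mod_cast h0
    rw [← mul_div_assoc, div_le_iff₀ this, mul_comm α]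
    gcongr

lemma meas_card (A : Finset ℕ) (p : ℕ → (ℕ → ℝ) → Prop)
    [∀ s, DecidablePred (fun a => p a s)]
    (hp : ∀ a, MeasurableSet {s | p a s}) :
    Measurable (fun s : ℕ → ℝ => (A.filter (fun a => p a s)).card) := by
  simp_rw [Finset.card_filter]
  apply Finset.measurable_sum
  intro a _
  exact Measurable.ite (hp a) measurable_const measurable_const

lemma meas_cC (n j : ℕ) : Measurable (fun s => cC n s j) := by
  unfold cC
  apply meas_card
  intro a
  exact measurableSet_le (measurable_pi_apply _) (measurable_pi_apply _)

lemma meas_cD (n m j : ℕ) : Measurable (fun s => cD n m s j) := by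
  unfold cD
  apply meas_card _ (fun a s => s (n + j) ≤ s (n + a))
  intro a
  exact measurableSet_le (measurable_pi_apply _) (measurable_pi_apply _)

lemma meas_cN (n m t : ℕ) : Measurable (fun s => cN n m t s) := by
  unfold cN
  apply meas_card _ (fun a s => t ≤ cC n s a)
  intro a
  exact measurableSet_le measurable_const (meas_cC n a)

lemma meas_real {f : (ℕ → ℝ) → ℕ} (hf : Measurable f) : Measurable (fun s => (f s : ℝ)) :=
  (measurable_of_countable (fun k : ℕ => (k : ℝ))).comp hf

lemma meas_sl (n m s0 : ℕ) (α : ℝ) : Measurable (fun s => sl n m s0 α s) := by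
  unfold sl
  exact (measurable_const.div ((meas_real (meas_cN n m s0)).add_const _)).sub_const _

lemma meas_ball (A : Finset ℕ) (p : ℕ → (ℕ → ℝ) → Prop)
    (hp : ∀ a, MeasurableSet {s | p a s}) : MeasurableSet {s | ∀ a ∈ A, p a s} := by
  have : {s | ∀ a ∈ A, p a s} = ⋂ a ∈ A, {s | p a s} := by
    ext s; simp
  rw [this]
  exact Finset.measurableSet_biInter _ (fun j _ => hp j)

lemma meas_EE (n m s0 : ℕ) (α : ℝ) (i : ℕ) : MeasurableSet {s | EE n m s0 α i s} := by
  have hv : ∀ j, Measurable (fun s => (1 + cC n s j : ℝ) - sl n m s0 α s * cD n m s j) := by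
    intro j
    exact ((meas_real (meas_cC n j)).const_add 1).sub
      ((meas_sl n m s0 α).mul (meas_real (meas_cD n m j)))
  unfold EE
  refine (measurableSet_lt measurable_const (meas_sl n m s0 α)).inter
    ((measurableSet_le (hv i) measurable_const).inter (MeasurableSet.inter ?_ ?_))
  · exact meas_ball _ _ (fun j => measurableSet_le (hv i) (hv j))
  · exact meas_ball _ _ (fun j => MeasurableSet.imp
      (measurableSet_lt (measurable_pi_apply _) (measurable_pi_apply _))
      (measurableSet_lt (hv i) (hv j)))

lemma meas_gE (n m s0 : ℕ) (α : ℝ) (i : ℕ) : Measurable (fun s => gE n m s0 α i s) := by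
  unfold gE
  exact Measurable.ite (meas_EE n m s0 α i) measurable_const measurable_const

lemma meas_gG (n m s0 : ℕ) (α : ℝ) (i : ℕ) : Measurable (fun s => gG n m s0 α i s) := by
  unfold gG
  exact Measurable.ite (measurableSet_le measurable_const (meas_cC n i))
    (measurable_const.div (meas_real (meas_cN n m (s0 + 1)))) measurable_const

lemma swap_int {Ω : Type*} [MeasurableSpace Ω] (μ : Measure Ω)
    (n m i l : ℕ) (S : Ω → ℕ → ℝ) (hS : Measurable S) (H0 : Finset ℕ) (hi : i ∈ H0)
    (hexch : ExchangeableNulls μ n H0 S) (hl : l ∈ II n i)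
    (g : (ℕ → ℝ) → ℝ) (hg : Measurable g) :
    ∫⁻ ω, ENNReal.ofReal (g (sw n i l (S ω))) ∂μ = ∫⁻ ω, ENNReal.ofReal (g (S ω)) ∂μ := by
  have h := hexch (Equiv.swap (n + i) l) (by
    intro j hj
    simp only [NullIdx, II, Finset.mem_union, Finset.mem_image, Finset.mem_insert, not_or] at *
    apply Equiv.swap_apply_of_ne_of_ne
    · rintro rfl
      exact hj.2 ⟨i, hi, rfl⟩
    · rintro rfl
      rcases hl with hl | hl
      · exact hj.2 ⟨i, hi, hl.symm⟩
      · exact hj.1 hl)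
  have hm1 : Measurable (fun ω => fun j => S ω (Equiv.swap (n + i) l j)) :=
    measurable_pi_lambda _ (fun j => (measurable_pi_apply _).comp hS)
  have hg' : Measurable (fun s => ENNReal.ofReal (g s)) := hg.ennreal_ofReal
  rw [← lintegral_map hg' hS, ← h, lintegral_map hg' hm1]
  rfl

lemma int_le {Ω : Type*} [MeasurableSpace Ω] (μ : Measure Ω)
    (n m s0 i : ℕ) (α : ℝ) (hα : 0 ≤ α) (hs0 : s0 < n) (S : Ω → ℕ → ℝ) (hS : Measurable S)
    (H0 : Finset ℕ) (hi : i ∈ H0) (him : i ∈ Finset.Icc 1 m)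
    (hexch : ExchangeableNulls μ n H0 S)
    (hdist : ∀ᵐ ω ∂μ, Set.InjOn (S ω) (Finset.Icc 1 (n + m))) :
    ∫⁻ ω, ENNReal.ofReal (gE n m s0 α i (S ω)) ∂μ ≤
      ∫⁻ ω, ENNReal.ofReal (gG n m s0 α i (S ω)) ∂μ := by
  have hE := meas_gE n m s0 α i
  have hG := meas_gG n m s0 α i
  have hsw : ∀ l, Measurable (fun ω => sw n i l (S ω)) := fun l =>
    measurable_pi_lambda _ (fun j => (measurable_pi_apply _).comp hS)
  have hE0 : ∀ s, 0 ≤ gE n m s0 α i s := by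
    intro s; unfold gE; split_ifs <;> norm_num
  have hG0 : ∀ s, 0 ≤ gG n m s0 α i s := by
    intro s; unfold gG; split_ifs <;> positivity
  have h1 : ∫⁻ ω, ∑ l ∈ II n i, ENNReal.ofReal (gE n m s0 α i (sw n i l (S ω))) ∂μ ≤
      ∫⁻ ω, ∑ l ∈ II n i, ENNReal.ofReal (gG n m s0 α i (sw n i l (S ω))) ∂μ := by
    apply lintegral_mono_ae
    filter_upwards [hdist] with ω hω
    rw [← ENNReal.ofReal_sum_of_nonneg (fun l _ => hE0 _),
      ← ENNReal.ofReal_sum_of_nonneg (fun l _ => hG0 _)]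
    exact ENNReal.ofReal_le_ofReal (pointwise n m s0 α i him (S ω) hω hα hs0)
  have hE1 : ∀ l ∈ II n i, Measurable
      (fun ω => ENNReal.ofReal (gE n m s0 α i (sw n i l (S ω)))) :=
    fun l _ => (hE.comp (hsw l)).ennreal_ofReal
  have hG1 : ∀ l ∈ II n i, Measurable
      (fun ω => ENNReal.ofReal (gG n m s0 α i (sw n i l (S ω)))) :=
    fun l _ => (hG.comp (hsw l)).ennreal_ofReal
  rw [lintegral_finsetSum _ hE1, lintegral_finsetSum _ hG1,
    Finset.sum_congr rfl (fun l hl => swap_int μ n m i l S hS H0 hi hexch hl _ hE),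
    Finset.sum_congr rfl (fun l hl => swap_int μ n m i l S hS H0 hi hexch hl _ hG),
    Finset.sum_const, Finset.sum_const, nsmul_eq_mul, nsmul_eq_mul] at h1
  have hc : ((II n i).card : ENNReal) ≠ 0 := by
    simp [II]
  exact (ENNReal.mul_le_mul_iff_right hc (ENNReal.natCast_ne_top _)).1 h1

lemma maxArgmin_spec (m : ℕ) (f : ℕ → ℝ) :
    maxArgmin m f ≤ m ∧ (∀ k ≤ m, f (maxArgmin m f) ≤ f k) ∧
      ∀ k ≤ m, maxArgmin m f < k → f (maxArgmin m f) < f k := by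
  have hne : {k | k ≤ m ∧ ∀ k' ≤ m, f k ≤ f k'}.Nonempty := by
    obtain ⟨k, hk, h⟩ := Finset.exists_min_image (Finset.Iic m) f ⟨0, by simp⟩
    exact ⟨k, by simpa using hk, fun k' hk' => h k' (by simpa using hk')⟩
  have hb : BddAbove {k | k ≤ m ∧ ∀ k' ≤ m, f k ≤ f k'} := ⟨m, fun k hk => hk.1⟩
  have hmem := Nat.sSup_mem hne hb
  refine ⟨hmem.1, hmem.2, fun k hk hlt => ?_⟩
  by_contra hcon
  have : k ≤ maxArgmin m f := le_csSup hb ⟨hk, fun k' hk' => (not_lt.1 hcon).trans (hmem.2 k' hk')⟩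
  omega

lemma cD_sigma (n m : ℕ) (s : ℕ → ℝ) (σ : ℕ → ℕ) (h : SortsTest n m s σ) (k : ℕ)
    (hk : k ∈ Finset.Icc 1 m) : cD n m s (σ k) = k := by
  obtain ⟨-, hbij, hlt⟩ := h
  unfold cD
  have : (Finset.Icc 1 m).filter (fun l => s (n + σ k) ≤ s (n + l)) =
      (Finset.Icc 1 k).image σ := by
    ext x
    rw [Finset.mem_filter, Finset.mem_image]
    constructor
    · rintro ⟨hx, hle⟩
      obtain ⟨k', hk', rfl⟩ := hbij.surjOn (Finset.mem_coe.2 hx)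
      refine ⟨k', ?_, rfl⟩
      have hk'' := Finset.mem_coe.1 hk'
      by_contra hcon
      have : k < k' := by
        rw [Finset.mem_Icc] at hcon hk''; omega
      exact absurd (hlt k hk k' hk'' this) (not_lt.2 hle)
    · rintro ⟨k', hk', rfl⟩
      have hk2 : k' ∈ Finset.Icc 1 m := by
        rw [Finset.mem_Icc] at *; omega
      refine ⟨Finset.mem_coe.1 (hbij.mapsTo (Finset.mem_coe.2 hk2)), ?_⟩
      rcases eq_or_lt_of_le (Finset.mem_Icc.1 hk').2 with h | h
      · rw [h]
      · exact (hlt k' hk2 k hk h).le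
  rw [this, Finset.card_image_of_injOn]
  · simp
  · refine hbij.injOn.mono ?_
    intro x hx
    simp only [Finset.coe_Icc, Set.mem_Icc, Finset.mem_Icc] at *
    omega

lemma slope_eq (n m s0 : ℕ) (α : ℝ) (hm : 1 ≤ m) (hs0 : s0 < n) (s : ℕ → ℝ) :
    α / (m * storey n m s0 s) - 1 / (n + 1) = sl n m s0 α s / (n + 1) := by
  have hn1 : (0 : ℝ) < n + 1 := by positivity
  have hN : ((Finset.Icc 1 m).filter
      (fun i => ((s0 : ℝ) + 1) / (n + 1) ≤ pval n s i)).card = cN n m s0 s := by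
    unfold cN
    congr 1
    apply Finset.filter_congr
    intro i _
    unfold pval
    rw [div_le_div_iff_of_pos_right hn1, add_comm, add_le_add_iff_left]
    exact Nat.cast_le
  have hns : (0 : ℝ) < n - s0 := by
    have : (s0 : ℝ) < n := by exact_mod_cast hs0
    linarith
  have hm0 : (m : ℝ) ≠ 0 := by positivity
  unfold storey sl
  rw [hN]
  have e : (1 - ((s0 : ℝ) + 1) / (n + 1)) = (n - s0) / (n + 1) := by field_simp; ring
  rw [e]
  have hc : (1 + cN n m s0 s : ℝ) ≠ 0 := by positivity
  have hc' : (cN n m s0 s + 1 : ℝ) ≠ 0 := by positivity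
  have hns' := hns.ne'
  field_simp
  ring

lemma EE_of_khat (n m s0 : ℕ) (α : ℝ) (hm : 1 ≤ m) (hs0 : s0 < n)
    (s : ℕ → ℝ) (σ : ℕ → ℕ) (hσ : SortsTest n m s σ) (hk : 1 ≤ khatASLC n m s0 α s σ) :
    EE n m s0 α (σ (khatASLC n m s0 α s σ)) s := by
  have hn1 : (0 : ℝ) < n + 1 := by positivity
  obtain ⟨h1, h2, h3⟩ := maxArgmin_spec m (fun k =>
    pOrd n s σ k - k * max (α / (m * storey n m s0 s) - 1 / (n + 1)) 0)
  change khatASLC n m s0 α s σ ≤ m at h1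
  change ∀ k ≤ m, khatASLC n m s0 α s σ < k → _ at h3
  change ∀ k ≤ m, pOrd n s σ (khatASLC n m s0 α s σ) - (khatASLC n m s0 α s σ : ℕ) * max _ 0 ≤ _
    at h2
  change ∀ k ≤ m, khatASLC n m s0 α s σ < k →
    pOrd n s σ (khatASLC n m s0 α s σ) - (khatASLC n m s0 α s σ : ℕ) * max _ 0 < _ at h3
  generalize khatASLC n m s0 α s σ = K at *
  rw [slope_eq n m s0 α hm hs0] at h2 h3
  have hp : ∀ k, 1 ≤ k → pOrd n s σ k = (1 + cC n s (σ k)) / (n + 1) := by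
    intro k hk
    unfold pOrd pval cC
    rw [if_neg (by omega)]
  have hB : 0 < sl n m s0 α s := by
    by_contra hcon
    have := h2 0 (Nat.zero_le _)
    rw [max_eq_right (div_nonpos_of_nonpos_of_nonneg (not_lt.1 hcon) hn1.le), hp K hk] at this
    simp only [pOrd, if_true, mul_zero, sub_zero] at this
    have : (0 : ℝ) < (1 + cC n s (σ K)) / (n + 1) := by positivity
    linarith
  rw [max_eq_left (by positivity)] at h2 h3
  have hD := fun k hk => cD_sigma n m s σ hσ k hk
  have hKm : K ∈ Finset.Icc 1 m := Finset.mem_Icc.2 ⟨hk, h1⟩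
  have hv : ∀ k ∈ Finset.Icc 1 m, pOrd n s σ k - k * (sl n m s0 α s / (n + 1)) =
      ((1 + cC n s (σ k) : ℝ) - sl n m s0 α s * cD n m s (σ k)) / (n + 1) := by
    intro k hk
    rw [hD k hk, hp k (Finset.mem_Icc.1 hk).1]
    ring
  obtain ⟨-, hbij, hlt⟩ := hσ
  refine ⟨hB, ?_, ?_, ?_⟩
  · have := h2 0 (Nat.zero_le _)
    rw [hv K hKm] at this
    simp only [pOrd, if_true, Nat.cast_zero, zero_mul, sub_zero] at this
    rwa [div_le_iff₀ hn1, zero_mul] at this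
  · intro j hj
    obtain ⟨k, hk, rfl⟩ := hbij.surjOn (Finset.mem_coe.2 hj)
    have hk := Finset.mem_coe.1 hk
    have := h2 k (Finset.mem_Icc.1 hk).2
    rwa [hv K hKm, hv k hk, div_le_div_iff_of_pos_right hn1] at this
  · intro j hj hjs
    obtain ⟨k, hk, rfl⟩ := hbij.surjOn (Finset.mem_coe.2 hj)
    have hk := Finset.mem_coe.1 hk
    have hKk : K < k := by
      rcases lt_trichotomy K k with h | h | h
      · exact h
      · subst h; exact absurd hjs (lt_irrefl _)
      · exact absurd (hlt k hk K hKm h) (not_lt.2 hjs.le)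
    have := h3 k (Finset.mem_Icc.1 hk).2 hKk
    rwa [hv K hKm, hv k hk, div_lt_div_iff_of_pos_right hn1] at this


/-- Theorem 2.9 of the paper: under Assumption (A1), the ASLC
procedure at level `α ∈ (0,1)` with Storey parameter `s0 ∈ {0,…,n-1}` satisfies
`bFDR(ASLC) ≤ α`. -/
theorem ASLC_bFDR_control
    {Ω : Type*} [MeasurableSpace Ω] (μ : Measure Ω) [IsProbabilityMeasure μ]
    (n m : ℕ) (hn : 1 ≤ n) (hm : 1 ≤ m)
    (α : ℝ) (hα : α ∈ Set.Ioo (0 : ℝ) 1)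
    (s0 : ℕ) (hs0 : s0 ≤ n - 1)
    (S : Ω → ℕ → ℝ) (hS : Measurable S)
    (H0 : Finset ℕ) (hH0 : H0 ⊆ Finset.Icc 1 m)
    (hexch : ExchangeableNulls μ n H0 S)
    (hdist : ∀ᵐ ω ∂μ, Set.InjOn (S ω) (Finset.Icc 1 (n + m)))
    (σ : Ω → ℕ → ℕ) (hσ : ∀ᵐ ω ∂μ, SortsTest n m (S ω) (σ ω)) :
    μ {ω | 1 ≤ khatASLC n m s0 α (S ω) (σ ω)
          ∧ σ ω (khatASLC n m s0 α (S ω) (σ ω)) ∈ H0}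
      ≤ ENNReal.ofReal α := by
  have hs : s0 < n := by omega
  have hα0 : 0 ≤ α := hα.1.le
  have h1 : μ {ω | 1 ≤ khatASLC n m s0 α (S ω) (σ ω)
          ∧ σ ω (khatASLC n m s0 α (S ω) (σ ω)) ∈ H0} ≤
      μ (⋃ i ∈ H0, S ⁻¹' {s | EE n m s0 α i s}) := by
    apply measure_mono_ae
    filter_upwards [hσ] with ω hω hmem
    exact Set.mem_biUnion hmem.2 (EE_of_khat n m s0 α hm hs (S ω) (σ ω) hω hmem.1)
  have h2 : ∀ i ∈ H0, μ (S ⁻¹' {s | EE n m s0 α i s}) ≤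
      ∫⁻ ω, ENNReal.ofReal (gG n m s0 α i (S ω)) ∂μ := by
    intro i hi
    refine le_trans (le_of_eq ?_)
      (int_le μ n m s0 i α hα0 hs S hS H0 hi (hH0 hi) hexch hdist)
    rw [← lintegral_indicator_one (hS (meas_EE n m s0 α i))]
    congr 1
    ext ω
    by_cases h : EE n m s0 α i (S ω) <;> simp [gE, Set.indicator, h]
  have hG0 : ∀ i s, 0 ≤ gG n m s0 α i s := by
    intro i s; unfold gG; split_ifs <;> positivity
  calc _ ≤ _ := h1
    _ ≤ ∑ i ∈ H0, μ (S ⁻¹' {s | EE n m s0 α i s}) := measure_biUnion_finset_le _ _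
    _ ≤ ∑ i ∈ H0, ∫⁻ ω, ENNReal.ofReal (gG n m s0 α i (S ω)) ∂μ := Finset.sum_le_sum h2
    _ = ∫⁻ ω, ∑ i ∈ H0, ENNReal.ofReal (gG n m s0 α i (S ω)) ∂μ :=
      (lintegral_finsetSum _ (fun i _ => ((meas_gG n m s0 α i).comp hS).ennreal_ofReal)).symm
    _ ≤ ∫⁻ _, ENNReal.ofReal α ∂μ := by
      apply lintegral_mono
      intro ω
      simp only
      rw [← ENNReal.ofReal_sum_of_nonneg (fun i _ => hG0 i _)]
      exact ENNReal.ofReal_le_ofReal (sum_gG n m s0 α hα0 H0 hH0 (S ω))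
    _ = ENNReal.ofReal α := by simp


end
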